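/- arXiv:1612.01765 — 3 statements merged into one kernel-verified Lean document; each statement's English description precedes it below -/
import Mathlib

section
/- Let k, m, n be positive integers, let A_{ij} (for i = 1,...,k and j = 1,...,m) be n×n matrices with nonnegative real entries, and let α₁,...,αₘ be positive real numbers with α₁ + ⋯ + αₘ = 1. Then the matrix product (A₁₁^(α₁) ∘ ⋯ ∘ A₁ₘ^(αₘ)) (A₂₁^(α₁) ∘ ⋯ ∘ A₂ₘ^(αₘ)) ⋯ (A_{k1}^(α₁) ∘ ⋯ ∘ A_{km}^(αₘ)) is entrywise less than or equal to (A₁₁A₂₁⋯A_{k1})^(α₁) ∘ (A₁₂A₂₂⋯A_{k2})^(α₂) ∘ ⋯ ∘ (A₁ₘA₂ₘ⋯A_{km})^(αₘ). -/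
open scoped ENNReal NNReal BigOperators

/-- Spectral radius of a real matrix: the spectral radius of the corresponding
complex matrix (equivalently, the maximum modulus of its complex eigenvalues). -/
noncomputable def specRad {n : ℕ} (A : Matrix (Fin n) (Fin n) ℝ) : ℝ≥0∞ :=
  spectralRadius ℂ (A.map (fun x => (x : ℂ)))

/-- Operator norm of a real `n × n` matrix induced by the Euclidean norm on `ℝⁿ`. -/
noncomputable def opNorm {n : ℕ} (A : Matrix (Fin n) (Fin n) ℝ) : ℝ :=
  ‖LinearMap.toContinuousLinearMap (Matrix.toEuclideanLin A)‖

/-- The weighted Hadamard (Schur) geometric mean `A₁^(α₁) ∘ ⋯ ∘ Aₘ^(αₘ)`. -/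
noncomputable def hadWMean {n m : ℕ} (α : Fin m → ℝ)
    (A : Fin m → Matrix (Fin n) (Fin n) ℝ) : Matrix (Fin n) (Fin n) ℝ :=
  Matrix.of fun x y => ∏ j, (A j x y) ^ (α j)

/-- The ordered product `A 0 * A 1 * ⋯ * A (k-1)`. -/
def matListProd {n k : ℕ} (A : Fin k → Matrix (Fin n) (Fin n) ℝ) :
    Matrix (Fin n) (Fin n) ℝ :=
  (List.ofFn A).prod

/-- The set `Σ^k` of all products of `k` elements of `S`. -/
def setPow {n : ℕ} (S : Set (Matrix (Fin n) (Fin n) ℝ)) (k : ℕ) :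
    Set (Matrix (Fin n) (Fin n) ℝ) :=
  {B | ∃ A : Fin k → Matrix (Fin n) (Fin n) ℝ, (∀ i, A i ∈ S) ∧ B = matListProd A}

/-- The set `Ψ₁ Ψ₂ ⋯ Ψₘ` of products with the `j`-th factor from `Ψ j`. -/
def setProd {n m : ℕ} (Ψ : Fin m → Set (Matrix (Fin n) (Fin n) ℝ)) :
    Set (Matrix (Fin n) (Fin n) ℝ) :=
  {B | ∃ A : Fin m → Matrix (Fin n) (Fin n) ℝ, (∀ j, A j ∈ Ψ j) ∧ B = matListProd A}

/-- The weighted Hadamard geometric mean `Ψ₁^(α₁) ∘ ⋯ ∘ Ψₘ^(αₘ)` of sets. -/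
noncomputable def setHadWMean {n m : ℕ} (α : Fin m → ℝ)
    (Ψ : Fin m → Set (Matrix (Fin n) (Fin n) ℝ)) :
    Set (Matrix (Fin n) (Fin n) ℝ) :=
  {B | ∃ A : Fin m → Matrix (Fin n) (Fin n) ℝ, (∀ j, A j ∈ Ψ j) ∧ B = hadWMean α A}

/-- The generalized spectral radius `ρ(Σ) = limsup_{k→∞} (sup_{A ∈ Σ^k} ρ(A))^{1/k}`. -/
noncomputable def genSpecRad {n : ℕ} (S : Set (Matrix (Fin n) (Fin n) ℝ)) : ℝ≥0∞ :=
  Filter.atTop.limsup fun k : ℕ => (⨆ B ∈ setPow S k, specRad B) ^ (1 / (k : ℝ))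

/-- The joint spectral radius `ρ̂(Σ) = limsup_{k→∞} (sup_{A ∈ Σ^k} ‖A‖)^{1/k}`. -/
noncomputable def jointSpecRad {n : ℕ} (S : Set (Matrix (Fin n) (Fin n) ℝ)) : ℝ≥0∞ :=
  Filter.atTop.limsup fun k : ℕ =>
    (⨆ B ∈ setPow S k, ENNReal.ofReal (opNorm B)) ^ (1 / (k : ℝ))

/-- Hölder's inequality for a weighted geometric mean of finitely many nonnegative functions. -/
theorem sum_prod_rpow_le_prod_sum_rpow {ι κ : Type*} (s : Finset ι) (t : Finset κ)
    (α : ι → ℝ) (hα : ∀ j ∈ s, 0 ≤ α j) (hαsum : ∑ j ∈ s, α j = 1)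
    (f : ι → κ → ℝ) (hf : ∀ j ∈ s, ∀ z ∈ t, 0 ≤ f j z) :
    ∑ z ∈ t, ∏ j ∈ s, f j z ^ α j ≤ ∏ j ∈ s, (∑ z ∈ t, f j z) ^ α j := by
  set S : ι → ℝ := fun j => ∑ z ∈ t, f j z with hS
  have hS0 : ∀ j ∈ s, 0 ≤ S j := fun j hj => Finset.sum_nonneg (hf j hj)
  have hprod : 0 ≤ ∏ j ∈ s, S j ^ α j :=
    Finset.prod_nonneg fun j hj => Real.rpow_nonneg (hS0 j hj) _
  have hdiv : ∀ j ∈ s, ∀ z ∈ t, 0 ≤ f j z / S j := fun j hj z hz =>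
    div_nonneg (hf j hj z hz) (hS0 j hj)
  have hfactor : ∀ z ∈ t, ∏ j ∈ s, f j z ^ α j =
      (∏ j ∈ s, (f j z / S j) ^ α j) * ∏ j ∈ s, S j ^ α j := by
    intro z hz
    rw [← Finset.prod_mul_distrib]
    refine Finset.prod_congr rfl fun j hj => ?_
    rw [← Real.mul_rpow (hdiv j hj z hz) (hS0 j hj),
      div_mul_cancel_of_imp fun h => (Finset.sum_eq_zero_iff_of_nonneg (hf j hj)).1 h z hz]
  have hle : ∑ z ∈ t, ∏ j ∈ s, (f j z / S j) ^ α j ≤ 1 :=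
    calc ∑ z ∈ t, ∏ j ∈ s, (f j z / S j) ^ α j
        ≤ ∑ z ∈ t, ∑ j ∈ s, α j * (f j z / S j) :=
          Finset.sum_le_sum fun z hz => Real.geom_mean_le_arith_mean_weighted s α _ hα hαsum
            fun j hj => hdiv j hj z hz
      _ = ∑ j ∈ s, α j * (S j / S j) := by
          rw [Finset.sum_comm]
          simp only [← Finset.mul_sum, ← Finset.sum_div, hS]
      _ ≤ ∑ j ∈ s, α j :=
          Finset.sum_le_sum fun j hj => mul_le_of_le_one_right (hα j hj) (div_self_le_one _)
      _ = 1 := hαsum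
  rw [Finset.sum_congr rfl hfactor, ← Finset.sum_mul]
  exact mul_le_of_le_one_left hprod hle

theorem matListProd_zero {n : ℕ} (A : Fin 0 → Matrix (Fin n) (Fin n) ℝ) :
    matListProd A = 1 := by
  simp [matListProd]

theorem matListProd_succ {n k : ℕ} (A : Fin (k + 1) → Matrix (Fin n) (Fin n) ℝ) :
    matListProd A = A 0 * matListProd fun i => A i.succ := by
  simp [matListProd, List.ofFn_succ]

theorem matListProd_nonneg {n k : ℕ} (A : Fin k → Matrix (Fin n) (Fin n) ℝ)
    (hA : ∀ i x y, 0 ≤ A i x y) (x y : Fin n) : 0 ≤ matListProd A x y := by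
  induction k generalizing x y with
  | zero =>
    rw [matListProd_zero, Matrix.one_apply]
    split_ifs <;> norm_num
  | succ k ih =>
    rw [matListProd_succ, Matrix.mul_apply]
    exact Finset.sum_nonneg fun z _ => mul_nonneg (hA 0 x z) (ih _ (fun i => hA i.succ) z y)

theorem hadWMean_nonneg {n m : ℕ} (α : Fin m → ℝ) (A : Fin m → Matrix (Fin n) (Fin n) ℝ)
    (hA : ∀ j x y, 0 ≤ A j x y) (x y : Fin n) : 0 ≤ hadWMean α A x y := by
  rw [hadWMean, Matrix.of_apply]
  exact Finset.prod_nonneg fun j _ => Real.rpow_nonneg (hA j x y) _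

/-- The product of two weighted Hadamard geometric means is dominated by the mean of products. -/
theorem hadWMean_mul_le {n m : ℕ} (α : Fin m → ℝ) (hα : ∀ j, 0 ≤ α j)
    (hαsum : ∑ j, α j = 1) (A B : Fin m → Matrix (Fin n) (Fin n) ℝ)
    (hA : ∀ j x y, 0 ≤ A j x y) (hB : ∀ j x y, 0 ≤ B j x y) (x y : Fin n) :
    (hadWMean α A * hadWMean α B) x y ≤ hadWMean α (fun j => A j * B j) x y := by
  simp only [hadWMean, Matrix.mul_apply, Matrix.of_apply, ← Finset.prod_mul_distrib,
    ← Real.mul_rpow (hA _ _ _) (hB _ _ _)]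
  exact sum_prod_rpow_le_prod_sum_rpow _ _ α (fun j _ => hα j) hαsum
    (fun j z => A j x z * B j z y) fun j _ z _ => mul_nonneg (hA j x z) (hB j z y)

/-- Theorem 2.1 (inequality (4)), entrywise form for non-negative matrices. -/
theorem hadamard_mean_prod_entrywise_le {k m n : ℕ} (hk : 0 < k) (hm : 0 < m)
    (hn : 0 < n) (A : Fin k → Fin m → Matrix (Fin n) (Fin n) ℝ)
    (hA : ∀ i j x y, 0 ≤ A i j x y)
    (α : Fin m → ℝ) (hα : ∀ j, 0 < α j) (hαsum : ∑ j, α j = 1) :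
    ∀ x y, matListProd (fun i => hadWMean α (A i)) x y ≤
      hadWMean α (fun j => matListProd (fun i => A i j)) x y := by
  clear hk
  induction k with
  | zero =>
    intro x y
    simp only [matListProd_zero]
    rcases eq_or_ne x y with rfl | hxy
    · simp [hadWMean]
    · rw [Matrix.one_apply_ne hxy]
      refine hadWMean_nonneg α _ (fun _ a b => ?_) x y
      rw [Matrix.one_apply]
      split_ifs <;> norm_num
  | succ k ih =>
    intro x y
    simp only [matListProd_succ]
    refine le_trans ?_ (hadWMean_mul_le α (fun j => (hα j).le) hαsum (A 0)
      (fun j => matListProd fun i : Fin k => A i.succ j) (hA 0)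
      (fun j => matListProd_nonneg _ fun i => hA i.succ j) x y)
    rw [Matrix.mul_apply, Matrix.mul_apply]
    exact Finset.sum_le_sum fun z _ => mul_le_mul_of_nonneg_left
      (ih (fun i => A i.succ) (fun i => hA i.succ) z y) (hadWMean_nonneg α _ (hA 0) x z)
end

section
/- Let m, n be positive integers, let A₁,...,Aₘ be n×n matrices with nonnegative real entries, and let α₁,...,αₘ be positive real numbers with α₁ + ⋯ + αₘ = 1. Then ρ(A₁^(α₁) ∘ A₂^(α₂) ∘ ⋯ ∘ Aₘ^(αₘ)) ≤ ρ(A₁)^{α₁} ρ(A₂)^{α₂} ⋯ ρ(Aₘ)^{αₘ}. -/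
open scoped ENNReal NNReal BigOperators

section NonnegMatrix

open Filter Topology

/-- Hölder's inequality for finitely many functions on a finite set. -/
theorem NNReal.sum_prod_rpow_le_prod_sum_rpow {ι κ : Type*} [Fintype ι] [Fintype κ]
    (f : ι → κ → ℝ≥0) {p : ι → ℝ} (hp : ∑ i, p i = 1) (hp0 : ∀ i, 0 ≤ p i) :
    ∑ x, ∏ i, f i x ^ p i ≤ ∏ i, (∑ x, f i x) ^ p i := by
  let _ : MeasurableSpace κ := ⊤
  have h := ENNReal.lintegral_prod_norm_pow_le (μ := MeasureTheory.Measure.count) Finset.univ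
    (f := fun i x => (f i x : ℝ≥0∞)) (fun i _ => Measurable.of_discrete.aemeasurable) hp
    (fun i _ => hp0 i)
  simp only [MeasureTheory.lintegral_count, tsum_fintype] at h
  simp only [← ENNReal.coe_rpow_of_nonneg _ (hp0 _), ← ENNReal.ofNNReal_finsetSum,
    ← ENNReal.ofNNReal_finsetProd] at h
  exact_mod_cast h

namespace Matrix

variable {ι κ : Type*} [Fintype ι] [Fintype κ] [DecidableEq κ]

/-- The weighted Hadamard geometric mean of matrices over `ℝ≥0`. -/
noncomputable def nnHadamardMean (p : ι → ℝ) (a : ι → Matrix κ κ ℝ≥0) : Matrix κ κ ℝ≥0 :=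
  of fun x y => ∏ i, a i x y ^ p i

theorem nnHadamardMean_pow_apply_le {p : ι → ℝ} (hp : ∑ i, p i = 1) (hp0 : ∀ i, 0 < p i)
    (a : ι → Matrix κ κ ℝ≥0) (k : ℕ) (x y : κ) :
    (nnHadamardMean p a ^ k) x y ≤ nnHadamardMean p (fun i => a i ^ k) x y := by
  induction k generalizing x y with
  | zero =>
    by_cases hxy : x = y
    · subst hxy
      simp [nnHadamardMean]
    · simp [hxy]
  | succ k ih =>
    calc (nnHadamardMean p a ^ (k + 1)) x y
        = ∑ z, (nnHadamardMean p a ^ k) x z * nnHadamardMean p a z y := by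
          rw [pow_succ, mul_apply]
      _ ≤ ∑ z, nnHadamardMean p (fun i => a i ^ k) x z * nnHadamardMean p a z y := by
          gcongr with z
          exact ih x z
      _ = ∑ z, ∏ i, ((a i ^ k) x z * a i z y) ^ p i := by
          simp [nnHadamardMean, NNReal.mul_rpow, Finset.prod_mul_distrib]
      _ ≤ ∏ i, (∑ z, (a i ^ k) x z * a i z y) ^ p i :=
          NNReal.sum_prod_rpow_le_prod_sum_rpow _ hp fun i => (hp0 i).le
      _ = nnHadamardMean p (fun i => a i ^ (k + 1)) x y := by
          simp [nnHadamardMean, pow_succ, mul_apply]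

attribute [local instance] Matrix.linftyOpNormedRing Matrix.linftyOpNormedAlgebra

theorem nnnorm_map_algebraMap_eq_sup (a : Matrix κ κ ℝ≥0) :
    ‖a.map (algebraMap ℝ≥0 ℂ)‖₊ = Finset.univ.sup fun x => ∑ y, a x y := by
  simp [linfty_opNNNorm_def]

theorem sum_row_le_nnnorm_map_algebraMap (a : Matrix κ κ ℝ≥0) (x : κ) :
    ∑ y, a x y ≤ ‖a.map (algebraMap ℝ≥0 ℂ)‖₊ := by
  rw [nnnorm_map_algebraMap_eq_sup]
  exact Finset.le_sup (f := fun x => ∑ y, a x y) (Finset.mem_univ x)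

theorem nnnorm_nnHadamardMean_pow_le {p : ι → ℝ} (hp : ∑ i, p i = 1) (hp0 : ∀ i, 0 < p i)
    (a : ι → Matrix κ κ ℝ≥0) (k : ℕ) :
    ‖(nnHadamardMean p a).map (algebraMap ℝ≥0 ℂ) ^ k‖₊ ≤
      ∏ i, ‖(a i).map (algebraMap ℝ≥0 ℂ) ^ k‖₊ ^ p i := by
  simp only [← Matrix.map_pow]
  rw [nnnorm_map_algebraMap_eq_sup]
  refine Finset.sup_le fun x _ => ?_
  calc ∑ y, (nnHadamardMean p a ^ k) x y
      ≤ ∑ y, ∏ i, (a i ^ k) x y ^ p i := by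
        gcongr with y
        exact nnHadamardMean_pow_apply_le hp hp0 a k x y
    _ ≤ ∏ i, (∑ y, (a i ^ k) x y) ^ p i :=
        NNReal.sum_prod_rpow_le_prod_sum_rpow _ hp fun i => (hp0 i).le
    _ ≤ _ := by
        gcongr with i
        · exact (hp0 i).le
        · exact sum_row_le_nnnorm_map_algebraMap _ x

theorem spectralRadius_ne_top (B : Matrix κ κ ℂ) : spectralRadius ℂ B ≠ ⊤ := by
  refine ne_top_of_le_ne_top ?_ (spectrum.spectralRadius_le_pow_nnnorm_pow_one_div ℂ B 0)
  simp [ENNReal.mul_eq_top]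

theorem tendsto_nnnorm_pow_rpow_toNNReal_spectralRadius (B : Matrix κ κ ℂ) :
    Tendsto (fun k : ℕ => ‖B ^ k‖₊ ^ (1 / k : ℝ)) atTop (𝓝 (spectralRadius ℂ B).toNNReal) := by
  rw [← ENNReal.tendsto_coe, ENNReal.coe_toNNReal (spectralRadius_ne_top B)]
  simpa only [ENNReal.coe_rpow_of_nonneg _ (Nat.one_div_cast_nonneg _)] using
    spectrum.pow_nnnorm_pow_one_div_tendsto_nhds_spectralRadius B

theorem spectralRadius_nnHadamardMean_le {p : ι → ℝ} (hp : ∑ i, p i = 1) (hp0 : ∀ i, 0 < p i)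
    (a : ι → Matrix κ κ ℝ≥0) :
    spectralRadius ℂ ((nnHadamardMean p a).map (algebraMap ℝ≥0 ℂ)) ≤
      ∏ i, spectralRadius ℂ ((a i).map (algebraMap ℝ≥0 ℂ)) ^ p i := by
  have key : (spectralRadius ℂ ((nnHadamardMean p a).map (algebraMap ℝ≥0 ℂ))).toNNReal ≤
      ∏ i, (spectralRadius ℂ ((a i).map (algebraMap ℝ≥0 ℂ))).toNNReal ^ p i := by
    refine le_of_tendsto_of_tendsto' (tendsto_nnnorm_pow_rpow_toNNReal_spectralRadius _)
      (tendsto_finsetProd _ fun i _ =>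
        (tendsto_nnnorm_pow_rpow_toNNReal_spectralRadius _).nnrpow tendsto_const_nhds
          (Or.inr (hp0 i))) fun k => ?_
    calc _ ≤ (∏ i, ‖(a i).map (algebraMap ℝ≥0 ℂ) ^ k‖₊ ^ p i) ^ (1 / k : ℝ) := by
          gcongr
          exact nnnorm_nnHadamardMean_pow_le hp hp0 a k
      _ = _ := by
          rw [← NNReal.finsetProd_rpow]
          simp only [← NNReal.rpow_mul, mul_comm]
  rw [← ENNReal.coe_le_coe, ENNReal.ofNNReal_finsetProd] at key
  simpa only [ENNReal.coe_rpow_of_nonneg _ (hp0 _).le,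
    ENNReal.coe_toNNReal (spectralRadius_ne_top _)] using key

end Matrix

end NonnegMatrix

/-- Theorem 2.2, inequality (8): spectral radius of a weighted Hadamard
geometric mean. -/
theorem hadamard_mean_specRad_le {m n : ℕ} (hm : 0 < m) (hn : 0 < n)
    (A : Fin m → Matrix (Fin n) (Fin n) ℝ) (hA : ∀ j x y, 0 ≤ A j x y)
    (α : Fin m → ℝ) (hα : ∀ j, 0 < α j) (hαsum : ∑ j, α j = 1) :
    specRad (hadWMean α A) ≤ ∏ j, specRad (A j) ^ (α j) := by
  have h := Matrix.spectralRadius_nnHadamardMean_le hαsum hα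
    fun j => Matrix.of fun x y => (⟨A j x y, hA j x y⟩ : ℝ≥0)
  have hmean : (hadWMean α A).map (fun x => (x : ℂ)) = (Matrix.nnHadamardMean α fun j =>
      Matrix.of fun x y => (⟨A j x y, hA j x y⟩ : ℝ≥0)).map (algebraMap ℝ≥0 ℂ) := by
    ext x y
    simp only [hadWMean, Matrix.nnHadamardMean, Matrix.map_apply, Matrix.of_apply, map_prod,
      Complex.ofReal_prod]
    rfl
  rw [specRad, hmean]
  exact h
end

section
/- Let m, n be positive integers and let A₁, A₂, ..., Aₘ be n×n matrices with nonnegative real entries. Then ρ(A₁ ∘ A₂ ∘ ⋯ ∘ Aₘ) ≤ ρ(A₁ A₂ ⋯ Aₘ). -/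
open scoped ENNReal NNReal BigOperators

open Filter Topology

theorem Finset.sum_prod_le_prod_sum {ι κ R : Type*} [CommSemiring R] [PartialOrder R]
    [IsOrderedRing R] {s : Finset ι} (hs : s.Nonempty) (t : Finset κ) (c : ι → κ → R)
    (hc : ∀ i ∈ s, ∀ k ∈ t, 0 ≤ c i k) :
    ∑ k ∈ t, ∏ i ∈ s, c i k ≤ ∏ i ∈ s, ∑ k ∈ t, c i k := by
  induction hs using Finset.Nonempty.cons_induction with
  | singleton a => simp
  | cons a s ha hs ih =>
    have hs' : ∀ i ∈ s, ∀ k ∈ t, 0 ≤ c i k := fun i hi => hc i (mem_cons_of_mem hi)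
    have ha' : ∀ k ∈ t, 0 ≤ c a k := hc a (mem_cons_self a s)
    simp only [prod_cons]
    calc ∑ k ∈ t, c a k * ∏ i ∈ s, c i k
        ≤ ∑ k ∈ t, (∑ l ∈ t, c a l) * ∏ i ∈ s, c i k := sum_le_sum fun k hk =>
          mul_le_mul_of_nonneg_right (single_le_sum ha' hk) (prod_nonneg fun i hi => hs' i hi k hk)
      _ = (∑ l ∈ t, c a l) * ∑ k ∈ t, ∏ i ∈ s, c i k := (mul_sum ..).symm
      _ ≤ _ := mul_le_mul_of_nonneg_left (ih hs') (sum_nonneg ha')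

namespace Matrix

theorem list_prod_apply_nonneg {n : Type*} [Fintype n] [DecidableEq n]
    (L : List (Matrix n n ℝ)) (hL : ∀ M ∈ L, ∀ x y, 0 ≤ M x y) (x y : n) : 0 ≤ L.prod x y := by
  induction L generalizing x with
  | nil => simp only [List.prod_nil, one_apply]; split_ifs <;> simp
  | cons M L ih =>
    rw [List.prod_cons, mul_apply]
    exact Finset.sum_nonneg fun z _ => mul_nonneg (hL M (by simp) x z)
      (ih (fun N hN => hL N (by simp [hN])) z)

/-- A product of nonnegative matrices, each entrywise dominated by a Hadamard product, is dominated
by the Hadamard product of the corresponding products. -/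
theorem list_prod_apply_le_prod_list_prod_apply {n ι α : Type*} [Fintype n] [DecidableEq n]
    [Fintype ι] [Nonempty ι] (L : List α) (G : α → Matrix n n ℝ) (F : ι → α → Matrix n n ℝ)
    (hG : ∀ a x y, 0 ≤ G a x y) (hF : ∀ i a x y, 0 ≤ F i a x y)
    (hGF : ∀ a x y, G a x y ≤ ∏ i, F i a x y) (x y : n) :
    (L.map G).prod x y ≤ ∏ i, (L.map (F i)).prod x y := by
  induction L generalizing x with
  | nil =>
    by_cases h : x = y <;> simp [h]
  | cons a L ih =>
    simp only [List.map_cons, List.prod_cons, mul_apply]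
    have hL : ∀ i z, 0 ≤ (L.map (F i)).prod z y := fun i z =>
      list_prod_apply_nonneg _ (by simpa using fun b _ => hF i b) z y
    calc ∑ z, G a x z * (L.map G).prod z y
        ≤ ∑ z, ∏ i, F i a x z * (L.map (F i)).prod z y := Finset.sum_le_sum fun z _ => by
          rw [Finset.prod_mul_distrib]
          exact mul_le_mul (hGF a x z) (ih z)
            (list_prod_apply_nonneg _ (by simpa using fun b _ => hG b) z y)
            (Finset.prod_nonneg fun i _ => hF i a x z)
      _ ≤ _ := Finset.sum_prod_le_prod_sum Finset.univ_nonempty _ _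
          fun i _ z _ => mul_nonneg (hF i a x z) (hL i z)

theorem pow_apply_le_prod_pow_apply {n ι : Type*} [Fintype n] [DecidableEq n] [Fintype ι]
    [Nonempty ι] {Q : Matrix n n ℝ} {P : ι → Matrix n n ℝ} (hQ : ∀ x y, 0 ≤ Q x y)
    (hP : ∀ i x y, 0 ≤ P i x y) (hQP : ∀ x y, Q x y ≤ ∏ i, P i x y) (k : ℕ) (x y : n) :
    (Q ^ k) x y ≤ ∏ i, (P i ^ k) x y := by
  simpa using list_prod_apply_le_prod_list_prod_apply (List.replicate k ()) (fun _ => Q)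
    (fun i _ => P i) (fun _ => hQ) (fun i _ => hP i) (fun _ => hQP) x y

theorem pow_apply_nonneg' {n : Type*} [Fintype n] [DecidableEq n]
    {Q : Matrix n n ℝ} (hQ : ∀ x y, 0 ≤ Q x y) (k : ℕ) (x y : n) : 0 ≤ (Q ^ k) x y := by
  rw [← List.prod_replicate]
  exact list_prod_apply_nonneg _ (fun M hM => List.eq_of_mem_replicate hM ▸ hQ) x y

attribute [local instance] Matrix.linftyOpNormedRing Matrix.linftyOpNormedAlgebra

theorem linfty_opNNNorm_map_ofReal_le_prod {n ι : Type*} [Fintype n] [DecidableEq n] [Fintype ι]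
    [Nonempty ι] {Q : Matrix n n ℝ} {P : ι → Matrix n n ℝ} (hQ : ∀ x y, 0 ≤ Q x y)
    (hQP : ∀ x y, Q x y ≤ ∏ i, P i x y) :
    ‖Q.map ((↑) : ℝ → ℂ)‖₊ ≤ ∏ i, ‖(P i).map ((↑) : ℝ → ℂ)‖₊ := by
  have row_le (M : Matrix n n ℝ) (x : n) : ∑ y, ‖M x y‖₊ ≤ ‖M.map ((↑) : ℝ → ℂ)‖₊ := by
    rw [linfty_opNNNorm_def]
    simpa using Finset.le_sup (f := fun x => ∑ y, ‖M x y‖₊) (Finset.mem_univ x)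
  rw [linfty_opNNNorm_def]
  refine Finset.sup_le fun x _ => ?_
  calc ∑ y, ‖Q.map ((↑) : ℝ → ℂ) x y‖₊
      ≤ ∑ y, ∏ i, ‖P i x y‖₊ := Finset.sum_le_sum fun y _ => by
        rw [← nnnorm_prod, map_apply, Complex.nnnorm_real, ← NNReal.coe_le_coe, coe_nnnorm,
          coe_nnnorm, Real.norm_of_nonneg (hQ x y)]
        exact (hQP x y).trans (le_abs_self _)
    _ ≤ ∏ i, ∑ y, ‖P i x y‖₊ :=
        Finset.sum_prod_le_prod_sum Finset.univ_nonempty _ _ fun _ _ _ _ => zero_le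
    _ ≤ _ := Finset.prod_le_prod' fun i _ => row_le (P i) x

theorem map_ofReal_pow {n : Type*} [Fintype n] [DecidableEq n] (M : Matrix n n ℝ) (k : ℕ) :
    (M ^ k).map ((↑) : ℝ → ℂ) = M.map ((↑) : ℝ → ℂ) ^ k :=
  map_pow Complex.ofRealHom.mapMatrix M k

end Matrix

section SpecRad

open Matrix

variable {n : ℕ}

attribute [local instance] Matrix.linftyOpNormedRing Matrix.linftyOpNormedAlgebra

theorem tendsto_linfty_opNNNorm_specRad (M : Matrix (Fin n) (Fin n) ℝ) :
    Tendsto (fun k : ℕ => (‖(M ^ k).map ((↑) : ℝ → ℂ)‖₊ : ℝ≥0∞) ^ (1 / k : ℝ)) atTop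
      (𝓝 (specRad M)) := by
  have : CompleteSpace (Matrix (Fin n) (Fin n) ℂ) := FiniteDimensional.complete ℂ _
  simpa only [specRad, map_ofReal_pow] using
    spectrum.pow_nnnorm_pow_one_div_tendsto_nhds_spectralRadius (M.map ((↑) : ℝ → ℂ))

theorem specRad_ne_top (M : Matrix (Fin n) (Fin n) ℝ) : specRad M ≠ ∞ := by
  have : CompleteSpace (Matrix (Fin n) (Fin n) ℂ) := FiniteDimensional.complete ℂ _
  have h := spectrum.spectralRadius_le_pow_nnnorm_pow_one_div ℂ (M.map ((↑) : ℝ → ℂ)) 0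
  refine ne_top_of_le_ne_top ?_ h
  simp [ENNReal.mul_eq_top]

theorem specRad_le_prod {ι : Type*} [Fintype ι] [Nonempty ι] {Q : Matrix (Fin n) (Fin n) ℝ}
    {P : ι → Matrix (Fin n) (Fin n) ℝ} (hQ : ∀ x y, 0 ≤ Q x y) (hP : ∀ i x y, 0 ≤ P i x y)
    (hQP : ∀ x y, Q x y ≤ ∏ i, P i x y) : specRad Q ≤ ∏ i, specRad (P i) := by
  refine le_of_tendsto_of_tendsto' (tendsto_linfty_opNNNorm_specRad Q)
    (ENNReal.tendsto_finsetProd_of_ne_top _ (fun i _ => tendsto_linfty_opNNNorm_specRad (P i))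
      fun i _ => specRad_ne_top (P i)) fun k => ?_
  rw [ENNReal.prod_rpow_of_nonneg (by positivity), ← ENNReal.ofNNReal_finsetProd]
  gcongr
  exact linfty_opNNNorm_map_ofReal_le_prod (pow_apply_nonneg' hQ k)
    (pow_apply_le_prod_pow_apply hQ hP hQP k)

theorem specRad_pow_le (M : Matrix (Fin n) (Fin n) ℝ) {k : ℕ} (hk : k ≠ 0) :
    specRad M ^ k ≤ specRad (M ^ k) := by
  simpa only [specRad, map_ofReal_pow] using
    spectrum.spectralRadius_pow_le (M.map ((↑) : ℝ → ℂ)) k hk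

theorem spectralRadius_eq_iSup_diff_zero {𝕜 A : Type*} [NormedField 𝕜] [Ring A] [Algebra 𝕜 A]
    (a : A) : spectralRadius 𝕜 a = ⨆ z ∈ spectrum 𝕜 a \ {0}, (‖z‖₊ : ℝ≥0∞) := by
  refine le_antisymm (iSup₂_le fun z hz => ?_) (biSup_mono fun z hz => hz.1)
  rcases eq_or_ne z 0 with rfl | h
  · simp
  · exact le_iSup₂_of_le z ⟨hz, h⟩ le_rfl

theorem spectralRadius_mul_comm {𝕜 A : Type*} [NormedField 𝕜] [Ring A] [Algebra 𝕜 A] (a b : A) :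
    spectralRadius 𝕜 (a * b) = spectralRadius 𝕜 (b * a) := by
  rw [spectralRadius_eq_iSup_diff_zero, spectrum.nonzero_mul_comm,
    ← spectralRadius_eq_iSup_diff_zero]

theorem specRad_mul_comm (M N : Matrix (Fin n) (Fin n) ℝ) : specRad (M * N) = specRad (N * M) := by
  have h (M N : Matrix (Fin n) (Fin n) ℝ) :
      (M * N).map ((↑) : ℝ → ℂ) = M.map ((↑) : ℝ → ℂ) * N.map ((↑) : ℝ → ℂ) :=
    map_mul Complex.ofRealHom.mapMatrix M N
  simp only [specRad, h, spectralRadius_mul_comm (M.map _)]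

theorem specRad_prod_rotate (L : List (Matrix (Fin n) (Fin n) ℝ)) (k : ℕ) :
    specRad (L.rotate k).prod = specRad L.prod := by
  rw [List.rotate_eq_drop_append_take_mod, List.prod_append, specRad_mul_comm,
    List.prod_take_mul_prod_drop]

end SpecRad

/-- Huang's inequality (1): `ρ(A₁ ∘ A₂ ∘ ⋯ ∘ Aₘ) ≤ ρ(A₁ A₂ ⋯ Aₘ)` for
non-negative matrices. -/
theorem specRad_hadamard_prod_le {m n : ℕ} (hm : 0 < m) (hn : 0 < n)
    (A : Fin m → Matrix (Fin n) (Fin n) ℝ) (hA : ∀ j x y, 0 ≤ A j x y) :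
    specRad (Matrix.of fun x y => ∏ j, A j x y) ≤ specRad (matListProd A) := by
  have : NeZero m := ⟨hm.ne'⟩
  set H : Matrix (Fin n) (Fin n) ℝ := Matrix.of fun x y => ∏ j, A j x y
  have hH0 : ∀ x y, 0 ≤ H x y := fun x y => by
    simpa only [H, Matrix.of_apply] using Finset.prod_nonneg fun j _ => hA j x y
  have rotate_eq (j : Fin m) :
      (List.finRange m).map (fun l => A (l + j)) = (List.ofFn A).rotate j := by
    refine List.ext_getElem (by simp) fun l _ _ => ?_
    simp [List.getElem_rotate, Fin.add_def]
  have key : specRad (H ^ m) ≤ ∏ j : Fin m, specRad ((List.ofFn A).rotate j).prod := by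
    refine specRad_le_prod (Matrix.pow_apply_nonneg' hH0 m) (fun j => ?_) fun x y => ?_
    · exact Matrix.list_prod_apply_nonneg _ (by simpa [List.mem_ofFn] using hA)
    · have h := Matrix.list_prod_apply_le_prod_list_prod_apply (List.finRange m) (fun _ => H)
        (fun j l => A (l + j)) (fun _ => hH0) (fun _ _ => hA _)
        (fun l x y => (Equiv.prod_comp (Equiv.addLeft l) fun j => A j x y).ge) x y
      simpa [rotate_eq] using h
  simp only [specRad_prod_rotate, Finset.prod_const, Finset.card_univ, Fintype.card_fin] at key
  exact (ENNReal.pow_le_pow_left_iff hm.ne').1 ((specRad_pow_le H hm.ne').trans key)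
end
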